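/- Let J be a positive half-integer with N := 2J ∈ ℕ, and work in ℂ^{N+1} with orthonormal basis e_m indexed by m ∈ {J, J−1, …, −J}. Define the matrices J_z e_m := m·e_m, J_− e_m := √(J(J+1) − m(m−1))·e_{m−1} (with J_− e_{−J} = 0), J_+ := (J_−)^†, and J_y := (J_+ − J_−)/(2i), and the rotation matrix R(θ,φ) := exp(iφ·J_z)·exp(iθ·J_y) for θ, φ ∈ ℝ. Then for all θ, φ, the squared norm ‖J_− R(θ,φ) e_J‖² = ⟨e_J, R(θ,φ)^† J_+ J_− R(θ,φ) e_J⟩ equals 2J · cos²(θ/2) · [1 + 2J − (2J−1)·cos θ]/2; in particular it is independent of φ. -/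

import Mathlib

open Matrix Complex

/-- The spin quantum number `J = N/2` for `N = 2J`. -/
noncomputable def spinJ (N : ℕ) : ℝ := (N : ℝ) / 2

/-- The magnetic quantum number `m = J − k` attached to the basis vector `e_k`,
`k = 0, …, N` (so `e_0 = e_J` is the spin-up state and `e_N = e_{−J}`). -/
noncomputable def mIdx (N : ℕ) (k : Fin (N + 1)) : ℝ := spinJ N - (k : ℕ)

/-- The matrix `J_z`, acting as `J_z e_m = m e_m`. -/
noncomputable def Jz (N : ℕ) : Matrix (Fin (N + 1)) (Fin (N + 1)) ℂ :=
  Matrix.diagonal fun k => (mIdx N k : ℂ)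

/-- The lowering matrix `J_−`, acting as
`J_− e_m = √(J(J+1) − m(m−1)) e_{m−1}` (and `J_− e_{−J} = 0`). -/
noncomputable def Jminus (N : ℕ) : Matrix (Fin (N + 1)) (Fin (N + 1)) ℂ :=
  fun i j =>
    if (i : ℕ) = (j : ℕ) + 1 then
      ((Real.sqrt (spinJ N * (spinJ N + 1) - mIdx N j * (mIdx N j - 1)) : ℝ) : ℂ)
    else 0

/-- The raising matrix `J_+ = (J_−)^†`. -/
noncomputable def Jplus (N : ℕ) : Matrix (Fin (N + 1)) (Fin (N + 1)) ℂ :=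
  (Jminus N)ᴴ

/-- The matrix `J_y = (J_+ − J_−)/(2i)`. -/
noncomputable def Jy (N : ℕ) : Matrix (Fin (N + 1)) (Fin (N + 1)) ℂ :=
  (2 * Complex.I)⁻¹ • (Jplus N - Jminus N)

/-- The rotation matrix `R(θ,φ) = exp(iφ J_z)·exp(iθ J_y)`. -/
noncomputable def Rrot (N : ℕ) (θ φ : ℝ) : Matrix (Fin (N + 1)) (Fin (N + 1)) ℂ :=
  NormedSpace.exp ((φ : ℂ) • Complex.I • Jz N) *
    NormedSpace.exp ((θ : ℂ) • Complex.I • Jy N)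

open scoped Matrix.Norms.Operator in
theorem exp_ode_aux {n : ℕ} (A : Matrix (Fin n) (Fin n) ℂ) (v : ℝ → Fin n → ℂ)
    (hv : ∀ t i, HasDerivAt (fun s => v s i) (A.mulVec (v t) i) t) (t : ℝ) :
    (NormedSpace.exp (t • A)).mulVec (v 0) = v t := by
  let V : ℝ → Matrix (Fin n) (Fin n) ℂ := fun t => Matrix.of fun i _ => v t i
  have hV : ∀ t, HasDerivAt V (A * V t) t := by
    intro t
    refine hasDerivAt_pi.2 fun i => hasDerivAt_pi.2 fun j => ?_
    exact hv t i
  have hE : ∀ t : ℝ, HasDerivAt (fun s : ℝ => NormedSpace.exp (s • (-A)))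
      (NormedSpace.exp (t • (-A)) * (-A)) t := fun t => hasDerivAt_exp_smul_const (-A) t
  have hF : ∀ t, HasDerivAt (fun s : ℝ => NormedSpace.exp (s • (-A)) * V s) 0 t := by
    intro t
    have := (hE t).mul (hV t)
    refine HasDerivAt.congr_deriv this ?_
    noncomm_ring
  have hc := is_const_of_deriv_eq_zero (fun t => (hF t).differentiableAt) (fun t => (hF t).deriv)
    t 0
  simp only [zero_smul, NormedSpace.exp_zero, one_mul] at hc
  have hinv : NormedSpace.exp (t • A) * NormedSpace.exp (t • (-A)) = 1 := by
    rw [smul_neg, ← Matrix.exp_add_of_commute (t • A) (-(t • A)) (Commute.neg_right (Commute.refl (t • A))),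
      add_neg_cancel, NormedSpace.exp_zero]
  have h2 : NormedSpace.exp (t • A) * V 0 = V t := by
    rw [← hc, ← mul_assoc, hinv, one_mul]
  funext i
  have := congrFun (congrFun h2 i) i
  exact this

/-- coefficient of the lowering operator -/
noncomputable def aC (N k : ℕ) : ℝ := Real.sqrt (((k : ℝ) + 1) * ((N : ℝ) - k))

theorem Jminus_apply' (N : ℕ) (i j : Fin (N + 1)) :
    Jminus N i j = if (i : ℕ) = (j : ℕ) + 1 then ((aC N j : ℝ) : ℂ) else 0 := by
  unfold Jminus aC mIdx spinJ
  congr 4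
  ring

theorem Jminus_zero (N : ℕ) (v : Fin (N + 1) → ℂ) : (Jminus N).mulVec v 0 = 0 := by
  simp [Matrix.mulVec, dotProduct, Jminus_apply']

theorem Jminus_succ (N : ℕ) (v : Fin (N + 1) → ℂ) (k : Fin N) :
    (Jminus N).mulVec v k.succ = aC N k * v k.castSucc := by
  simp only [Matrix.mulVec, dotProduct, Jminus_apply']
  rw [Finset.sum_eq_single k.castSucc]
  · simp
  · intro b _ hb
    rw [if_neg, zero_mul]
    intro h
    apply hb
    ext
    simp at h ⊢
    omega
  · simp

theorem Jplus_castSucc (N : ℕ) (v : Fin (N + 1) → ℂ) (k : Fin N) :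
    (Jplus N).mulVec v k.castSucc = aC N k * v k.succ := by
  simp only [Matrix.mulVec, dotProduct, Jplus, Matrix.conjTranspose_apply, Jminus_apply']
  rw [Finset.sum_eq_single k.succ]
  · simp
  · intro b _ hb
    rw [if_neg, star_zero, zero_mul]
    intro h
    apply hb
    ext
    simpa using h
  · simp

theorem Jplus_last (N : ℕ) (v : Fin (N + 1) → ℂ) :
    (Jplus N).mulVec v (Fin.last N) = 0 := by
  simp only [Matrix.mulVec, dotProduct, Jplus, Matrix.conjTranspose_apply, Jminus_apply']
  refine Finset.sum_eq_zero fun j _ => ?_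
  rw [if_neg, star_zero, zero_mul]
  have := j.2
  simp
  omega

/-- spin coherent state amplitudes -/
noncomputable def cs (N : ℕ) (t : ℝ) (k : ℕ) : ℝ :=
  Real.sqrt (N.choose k) * (Real.cos (t / 2) ^ (N - k) * (-Real.sin (t / 2)) ^ k)

theorem aC_up (N k : ℕ) (hk : k < N) :
    aC N k * Real.sqrt (N.choose (k + 1)) = ((N : ℝ) - k) * Real.sqrt (N.choose k) := by
  have h : (0 : ℝ) ≤ (N : ℝ) - k := by
    have : (k : ℝ) ≤ N := by exact_mod_cast hk.le
    linarith
  have hc : (N.choose (k + 1) : ℝ) * (k + 1) = N.choose k * ((N : ℝ) - k) := by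
    rw [← Nat.cast_sub hk.le]
    exact_mod_cast Nat.choose_succ_right_eq N k
  unfold aC
  rw [← Real.sqrt_mul (by positivity)]
  rw [show ((k : ℝ) + 1) * (N - k) * (N.choose (k + 1)) = ((N : ℝ) - k) ^ 2 * N.choose k by
    linear_combination ((N : ℝ) - k) * hc]
  rw [Real.sqrt_mul (by positivity), Real.sqrt_sq h]

theorem aC_down (N k : ℕ) (hk : k < N) :
    aC N k * Real.sqrt (N.choose k) = ((k : ℝ) + 1) * Real.sqrt (N.choose (k + 1)) := by
  have h : (0 : ℝ) ≤ (N : ℝ) - k := by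
    have : (k : ℝ) ≤ N := by exact_mod_cast hk.le
    linarith
  have hc : (N.choose (k + 1) : ℝ) * (k + 1) = N.choose k * ((N : ℝ) - k) := by
    rw [← Nat.cast_sub hk.le]
    exact_mod_cast Nat.choose_succ_right_eq N k
  unfold aC
  rw [← Real.sqrt_mul (by positivity)]
  rw [show ((k : ℝ) + 1) * (N - k) * (N.choose k) = ((k : ℝ) + 1) ^ 2 * N.choose (k + 1) by
    linear_combination (-(k : ℝ) - 1) * hc]
  rw [Real.sqrt_mul (by positivity), Real.sqrt_sq (by positivity)]

theorem cs_deriv (N : ℕ) (t : ℝ) (k : ℕ) (hk : k ≤ N) : HasDerivAt (fun s => cs N s k)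
    (Real.sqrt (N.choose k) / 2 *
      (((N : ℝ) - k) * Real.cos (t / 2) ^ (N - k - 1) * (-Real.sin (t / 2)) ^ (k + 1)
        - k * Real.cos (t / 2) ^ (N - k + 1) * (-Real.sin (t / 2)) ^ (k - 1))) t := by
  have h2 : HasDerivAt (fun s : ℝ => s / 2) (1 / 2) t := (hasDerivAt_id t).div_const 2
  have hc := (h2.cos).fun_pow (N - k)
  have hs := (h2.sin).fun_neg.fun_pow k
  have := (hc.fun_mul hs).const_mul (Real.sqrt (N.choose k))
  unfold cs
  refine HasDerivAt.congr_deriv this ?_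
  rw [Nat.cast_sub hk]
  ring

theorem A_apply (N : ℕ) (v : Fin (N + 1) → ℂ) (i : Fin (N + 1)) :
    (((1 / 2 : ℂ)) • (Jplus N - Jminus N)).mulVec v i =
      1 / 2 * ((Jplus N).mulVec v i - (Jminus N).mulVec v i) := by
  rw [Matrix.smul_mulVec, Matrix.sub_mulVec]
  simp

theorem Jplus_cs (N : ℕ) (t : ℝ) (i : Fin (N + 1)) :
    (Jplus N).mulVec (fun k => ((cs N t k : ℝ) : ℂ)) i =
      ((Real.sqrt (N.choose i) * (((N : ℝ) - (i : ℕ)) * Real.cos (t / 2) ^ (N - i - 1) *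
        (-Real.sin (t / 2)) ^ ((i : ℕ) + 1)) : ℝ) : ℂ) := by
  induction i using Fin.lastCases with
  | last => rw [Jplus_last]; simp
  | cast k =>
    rw [Jplus_castSucc, ← Complex.ofReal_mul]
    congr 1
    have := aC_up N k k.2
    simp only [cs, Fin.val_succ, Fin.val_castSucc, Nat.sub_sub]
    linear_combination (Real.cos (t / 2) ^ (N - (k + 1)) *
        (-Real.sin (t / 2)) ^ ((k : ℕ) + 1)) * this

theorem Jminus_cs (N : ℕ) (t : ℝ) (i : Fin (N + 1)) :
    (Jminus N).mulVec (fun k => ((cs N t k : ℝ) : ℂ)) i =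
      ((Real.sqrt (N.choose i) * ((i : ℕ) * Real.cos (t / 2) ^ (N - i + 1) *
        (-Real.sin (t / 2)) ^ ((i : ℕ) - 1)) : ℝ) : ℂ) := by
  induction i using Fin.cases with
  | zero => rw [Jminus_zero]; simp
  | succ k =>
    rw [Jminus_succ, ← Complex.ofReal_mul]
    congr 1
    have := aC_down N k k.2
    have hk : N - (k + 1) + 1 = N - (k : ℕ) := by omega
    simp only [cs, Fin.val_succ, Fin.val_castSucc, hk, Nat.add_sub_cancel]
    push_cast
    linear_combination (Real.cos (t / 2) ^ (N - (k : ℕ)) *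
        (-Real.sin (t / 2)) ^ (k : ℕ)) * this

theorem exp_e0 (N : ℕ) (t : ℝ) :
    (NormedSpace.exp ((t : ℂ) • Complex.I • Jy N)).mulVec (Pi.single 0 1) =
      fun k : Fin (N + 1) => ((cs N t k : ℝ) : ℂ) := by
  have h := exp_ode_aux (((1 / 2 : ℂ)) • (Jplus N - Jminus N))
    (fun t (k : Fin (N + 1)) => ((cs N t k : ℝ) : ℂ)) (by
      intro t i
      rw [A_apply, Jplus_cs, Jminus_cs]
      have := (cs_deriv N t i (by omega)).ofReal_comp
      refine HasDerivAt.congr_deriv this ?_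
      push_cast
      ring) t
  have e : (t : ℂ) • Complex.I • Jy N = t • ((1 / 2 : ℂ)) • (Jplus N - Jminus N) := by
    rw [Jy, smul_smul Complex.I, Complex.coe_smul]
    congr 2
    field_simp
  rw [e, ← h]
  congr 1
  funext k
  induction k using Fin.cases with
  | zero => simp [cs]
  | succ k => simp [cs]

theorem binom_sum (M : ℕ) (x : ℝ) :
    ∑ k ∈ Finset.range (M + 1), ((k : ℝ) + 1) * (M.choose k * x ^ k * (1 - x) ^ (M - k))
      = 1 + M * x := by
  have h1 := congrArg (Polynomial.eval x) (bernsteinPolynomial.sum ℝ M)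
  have h2 := congrArg (Polynomial.eval x) (bernsteinPolynomial.sum_smul ℝ M)
  simp only [Polynomial.eval_finsetSum, bernsteinPolynomial, Polynomial.eval_smul, nsmul_eq_mul,
    Polynomial.eval_mul, Polynomial.eval_pow, Polynomial.eval_sub, Polynomial.eval_one,
    Polynomial.eval_X, Polynomial.eval_natCast] at h1 h2
  simp only [add_mul, Finset.sum_add_distrib, one_mul]
  rw [h1, h2]
  ring

/-- For a positive half-integer spin `J` with `N = 2J ∈ ℕ`, the squared norm
`‖J_− R(θ,φ) e_J‖²` of the lowered rotated spin-up state equals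
`2J·cos²(θ/2)·[1 + 2J − (2J−1)cos θ]/2`; in particular it is independent of `φ`. -/
theorem norm_sq_lowered_coherent (N : ℕ) (hN : 0 < N) (θ φ : ℝ) :
    ∑ i, ‖(Jminus N * Rrot N θ φ).mulVec (Pi.single 0 1) i‖ ^ 2 =
      2 * spinJ N * Real.cos (θ / 2) ^ 2 *
        ((1 + 2 * spinJ N - (2 * spinJ N - 1) * Real.cos θ) / 2) := by
  obtain ⟨M, rfl⟩ : ∃ M, N = M + 1 := ⟨N - 1, by omega⟩
  have hD : (φ : ℂ) • Complex.I • Jz (M + 1) =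
      Matrix.diagonal fun k => ((φ * mIdx (M + 1) k : ℝ) : ℂ) * Complex.I := by
    rw [Jz, ← Matrix.diagonal_smul, ← Matrix.diagonal_smul]
    congr 1
    funext k
    simp
    ring
  rw [Rrot, hD, Matrix.exp_diagonal, ← Matrix.mulVec_mulVec, ← Matrix.mulVec_mulVec, exp_e0,
    Fin.sum_univ_succ, Jminus_zero]
  simp only [Jminus_succ, Matrix.mulVec_diagonal, Pi.coe_exp, norm_mul, ← Complex.exp_eq_exp_ℂ,
    Complex.norm_exp_ofReal_mul_I, one_mul, Complex.norm_real, mul_pow, Real.norm_eq_abs, sq_abs,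
    norm_zero]
  have key : ∀ k : ℕ, k < M + 1 → aC (M + 1) k ^ 2 * cs (M + 1) θ k ^ 2 =
      (M + 1) * Real.cos (θ / 2) ^ 2 * (((k : ℝ) + 1) * (M.choose k * (Real.sin (θ / 2) ^ 2) ^ k *
        (1 - Real.sin (θ / 2) ^ 2) ^ (M - k))) := by
    intro k hk
    have hk' : (k : ℝ) ≤ M := by exact_mod_cast Nat.lt_succ_iff.1 hk
    have hch : (M.choose k : ℝ) * (M + 1) = (M + 1).choose k * (M + 1 - k) := by
      have := Nat.choose_mul_succ_eq M k
      have h2 : ((M + 1 - k : ℕ) : ℝ) = M + 1 - k := by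
        rw [Nat.cast_sub hk.le]; push_cast; ring
      rw [← h2]
      exact_mod_cast this
    have h0 : (0 : ℝ) ≤ ((k : ℝ) + 1) * (((M + 1 : ℕ) : ℝ) - k) := by
      push_cast
      exact mul_nonneg (by positivity) (by linarith)
    rw [aC, Real.sq_sqrt h0, cs, mul_pow, Real.sq_sqrt (by positivity), ← Real.cos_sq',
      show M + 1 - k = (M - k) + 1 by omega]
    have hs : ((-Real.sin (θ / 2)) ^ k) ^ 2 = (Real.sin (θ / 2) ^ 2) ^ k := by
      rw [← pow_mul, mul_comm, pow_mul, neg_sq]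
    rw [mul_pow, hs, ← pow_mul, ← pow_mul (Real.cos (θ / 2)), mul_comm (M - k + 1) 2, mul_add,
      pow_add]
    push_cast
    linear_combination (-((k : ℝ) + 1) * Real.cos (θ / 2) ^ (2 * (M - k)) *
      Real.cos (θ / 2) ^ 2 * (Real.sin (θ / 2) ^ 2) ^ k) * hch
  have hsum : ∑ k : Fin (M + 1), aC (M + 1) k ^ 2 * cs (M + 1) θ (k.castSucc : Fin (M + 2)) ^ 2 =
      (M + 1) * Real.cos (θ / 2) ^ 2 * (1 + M * Real.sin (θ / 2) ^ 2) := by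
    rw [← binom_sum, Finset.mul_sum, ← Fin.sum_univ_eq_sum_range (fun k : ℕ => 
      (M + 1) * Real.cos (θ / 2) ^ 2 * (((k : ℝ) + 1) * (M.choose k * (Real.sin (θ / 2) ^ 2) ^ k *
        (1 - Real.sin (θ / 2) ^ 2) ^ (M - k)))) (M + 1)]
    exact Finset.sum_congr rfl fun k _ => key k k.2
  rw [hsum, spinJ]
  have hcos : Real.cos θ = 1 - 2 * Real.sin (θ / 2) ^ 2 := by
    rw [show θ = 2 * (θ / 2) by ring, Real.cos_two_mul, Real.cos_sq']
    ring_nf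
  rw [hcos]
  push_cast
  ring
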